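/- Under the su(N) generator hypotheses, the Dirac matrices in the Dirac representation, and the Grassmann setup, the vector Fierz identity for U(N) fermions holds: Σ_{a : Fin (N^2−1)} Σ_{μ} ε μ • ⟪γ μ, T a⟫ * ⟪γ μ, T a⟫ = −(1/2) • ⟪1⟫ * ⟪1⟫ + ((N−2)/(4·N)) • Σ_{μ} ε μ • ⟪γ μ⟫ * ⟪γ μ⟫ + (1/4) • Σ_{μ} ε μ • ⟪γ5 * γ μ⟫ * ⟪γ5 * γ μ⟫ + (1/2) • ⟪γ5⟫ * ⟪γ5⟫, where μ ranges over Fin 4. -/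

import Mathlib

noncomputable section

open Complex Matrix

/-- The Dirac γ-matrices in the Dirac representation. -/
def γm : Fin 4 → Matrix (Fin 4) (Fin 4) ℂ :=
  ![!![1,0,0,0; 0,1,0,0; 0,0,-1,0; 0,0,0,-1],
    !![0,0,0,1; 0,0,1,0; 0,-1,0,0; -1,0,0,0],
    !![0,0,0,-I; 0,0,I,0; 0,I,0,0; -I,0,0,0],
    !![0,0,1,0; 0,0,0,-1; -1,0,0,0; 0,1,0,0]]

/-- γ⁵ = i·γ⁰γ¹γ²γ³. -/
def γ5 : Matrix (Fin 4) (Fin 4) ℂ := I • (γm 0 * γm 1 * γm 2 * γm 3)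

/-- σ^{μν} = (i/2)[γ^μ, γ^ν]. -/
def σm (μ ν : Fin 4) : Matrix (Fin 4) (Fin 4) ℂ := (I / 2) • (γm μ * γm ν - γm ν * γm μ)

/-- The metric signs ε 0 = 1, ε 1 = ε 2 = ε 3 = −1 used to raise/lower indices. -/
def εs : Fin 4 → ℤ := ![1, -1, -1, -1]

/-- The totally antisymmetric Levi-Civita symbol on four indices,
normalized by ε₄ 0 1 2 3 = 1. -/
def ε4 (κ l μ ν : Fin 4) : ℤ :=
  Matrix.det (Matrix.of fun p q : Fin 4 => if ![κ, l, μ, ν] p = q then (1 : ℤ) else 0)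

/-- The Grassmann algebra generated by the 8N fermion components:
the exterior algebra of the direct sum of two copies of (Fin 4 × Fin N) → ℂ. -/
abbrev GrassAlg (N : ℕ) :=
  ExteriorAlgebra ℂ (((Fin 4 × Fin N) → ℂ) × ((Fin 4 × Fin N) → ℂ))

/-- ψ (A, i): the image in the Grassmann algebra of the standard basis vector
of the first summand indexed by (A, i). -/
def ψv (N : ℕ) (A : Fin 4) (i : Fin N) : GrassAlg N :=
  ExteriorAlgebra.ι ℂ (Pi.single (A, i) 1, 0)

/-- ψ̄ (A, i): the image in the Grassmann algebra of the standard basis vector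
of the second summand indexed by (A, i). -/
def ψbar (N : ℕ) (A : Fin 4) (i : Fin N) : GrassAlg N :=
  ExteriorAlgebra.ι ℂ (0, Pi.single (A, i) 1)

/-- The fermion bilinear B Γ i j = ∑_{A,B} Γ A B · ψ̄ (A,i) ψ (B,j). -/
def Bgr (N : ℕ) (Γ : Matrix (Fin 4) (Fin 4) ℂ) (i j : Fin N) : GrassAlg N :=
  ∑ A : Fin 4, ∑ B : Fin 4, Γ A B • (ψbar N A i * ψv N B j)

/-- ⟪Γ, X⟫ = ∑_{i,j} X i j · B Γ i j, the bilinear with Dirac structure Γ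
and color structure X. -/
def pairing (N : ℕ) (Γ : Matrix (Fin 4) (Fin 4) ℂ)
    (X : Matrix (Fin N) (Fin N) ℂ) : GrassAlg N :=
  ∑ i : Fin N, ∑ j : Fin N, X i j • Bgr N Γ i j

/-- ⟪Γ⟫ = ⟪Γ, 1⟫, the color-singlet bilinear. -/
def sing (N : ℕ) (Γ : Matrix (Fin 4) (Fin 4) ℂ) : GrassAlg N := pairing N Γ 1

def Qm (N : ℕ) (A : Fin 4) (i : Fin N) (B : Fin 4) (j : Fin N) (C : Fin 4) (k : Fin N)
    (D : Fin 4) (l : Fin N) : GrassAlg N :=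
  (ψbar N A i * ψv N B j) * (ψbar N C k * ψv N D l)

lemma ι_swap {V : Type*} [AddCommGroup V] [Module ℂ V] (x y : V) :
    ExteriorAlgebra.ι ℂ x * ExteriorAlgebra.ι ℂ y
      = -(ExteriorAlgebra.ι ℂ y * ExteriorAlgebra.ι ℂ x) :=
  eq_neg_of_add_eq_zero_left (ExteriorAlgebra.ι_add_mul_swap x y)

lemma Qm_swap (N : ℕ) (A : Fin 4) (i : Fin N) (B : Fin 4) (j : Fin N) (C : Fin 4) (k : Fin N)
    (D : Fin 4) (l : Fin N) : Qm N A i B j C k D l = - Qm N A i D l C k B j := by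
  have h1 : ψv N B j * ψbar N C k = -(ψbar N C k * ψv N B j) := ι_swap _ _
  have h2 : ψv N B j * ψv N D l = -(ψv N D l * ψv N B j) := ι_swap _ _
  have h3 : ψbar N C k * ψv N D l = -(ψv N D l * ψbar N C k) := ι_swap _ _
  unfold Qm
  calc _ = ψbar N A i * (ψv N B j * ψbar N C k) * ψv N D l := by noncomm_ring
    _ = -(ψbar N A i * ψbar N C k * (ψv N B j * ψv N D l)) := by rw [h1]; noncomm_ring
    _ = ψbar N A i * (ψbar N C k * ψv N D l) * ψv N B j := by rw [h2]; noncomm_ring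
    _ = _ := by rw [h3]; noncomm_ring

/-- The quartic with Dirac tensor `G` and color tensor `X`. -/
def Fm (N : ℕ) (G : Fin 4 → Fin 4 → Fin 4 → Fin 4 → ℂ) (X : Fin N → Fin N → Fin N → Fin N → ℂ) :
    GrassAlg N :=
  ∑ i, ∑ j, ∑ k, ∑ l, ∑ A, ∑ B, ∑ C, ∑ D, (X i j k l * G A B C D) • Qm N A i B j C k D l

lemma pair_mul (N : ℕ) (Γ Γ' : Matrix (Fin 4) (Fin 4) ℂ) (X X' : Matrix (Fin N) (Fin N) ℂ) :
    pairing N Γ X * pairing N Γ' X' =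
      Fm N (fun A B C D => Γ A B * Γ' C D) (fun i j k l => X i j * X' k l) := by
  have hB : ∀ i j k l, Bgr N Γ i j * Bgr N Γ' k l =
      ∑ A, ∑ B, ∑ C, ∑ D, (Γ A B * Γ' C D) • Qm N A i B j C k D l := by
    intro i j k l
    unfold Bgr
    rw [Finset.sum_mul]
    refine Finset.sum_congr rfl fun A _ => ?_
    rw [Finset.sum_mul]
    refine Finset.sum_congr rfl fun B _ => ?_
    rw [Finset.mul_sum]
    refine Finset.sum_congr rfl fun C _ => ?_
    rw [Finset.mul_sum]
    refine Finset.sum_congr rfl fun D _ => ?_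
    rw [smul_mul_smul_comm]
    rfl
  unfold pairing Fm
  simp only [Finset.sum_mul]
  refine Finset.sum_congr rfl fun i _ => Finset.sum_congr rfl fun j _ => ?_
  simp only [Finset.mul_sum]
  refine Finset.sum_congr rfl fun k _ => Finset.sum_congr rfl fun l _ => ?_
  rw [smul_mul_smul_comm, hB]
  simp only [Finset.smul_sum, smul_smul]

lemma Fm_smul (N : ℕ) (c : ℂ) (G X) : c • Fm N G X = Fm N (fun A B C D => c * G A B C D) X := by
  unfold Fm
  simp only [Finset.smul_sum, smul_smul]
  simp only [mul_left_comm]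

lemma Fm_smulX (N : ℕ) (c : ℂ) (G X) : Fm N G (fun i j k l => c * X i j k l) = c • Fm N G X := by
  unfold Fm
  simp only [Finset.smul_sum, smul_smul, mul_assoc]

lemma Fm_add (N : ℕ) (G G' X) :
    Fm N G X + Fm N G' X = Fm N (fun A B C D => G A B C D + G' A B C D) X := by
  unfold Fm
  simp only [← Finset.sum_add_distrib, ← add_smul, mul_add]

lemma Fm_zero (N : ℕ) (X) : Fm N (fun _ _ _ _ => 0) X = 0 := by
  simp [Fm]

lemma Fm_sum (N : ℕ) {ι : Type*} (s : Finset ι) (G : ι → Fin 4 → Fin 4 → Fin 4 → Fin 4 → ℂ) (X) :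
    ∑ m ∈ s, Fm N (G m) X = Fm N (fun A B C D => ∑ m ∈ s, G m A B C D) X := by
  classical
  induction s using Finset.induction_on with
  | empty => simp [Fm_zero]
  | insert a s ha ih => simp only [Finset.sum_insert ha, ih, Fm_add]

lemma Fm_addX (N : ℕ) (G X X') :
    Fm N G X + Fm N G X' = Fm N G (fun i j k l => X i j k l + X' i j k l) := by
  unfold Fm
  simp only [← Finset.sum_add_distrib, ← add_smul, add_mul]

lemma Fm_zeroX (N : ℕ) (G) : Fm N G (fun _ _ _ _ => 0) = 0 := by
  simp [Fm]

lemma Fm_sumX (N : ℕ) {ι : Type*} (s : Finset ι) (G) (X : ι → Fin N → Fin N → Fin N → Fin N → ℂ) :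
    ∑ m ∈ s, Fm N G (X m) = Fm N G (fun i j k l => ∑ m ∈ s, X m i j k l) := by
  classical
  induction s using Finset.induction_on with
  | empty => simp [Fm_zeroX]
  | insert a s ha ih => simp only [Finset.sum_insert ha, ih, Fm_addX]

/-- Grassmann exchange of the two `ψ` fields. -/
lemma Fm_swap (N : ℕ) (G X) :
    Fm N G X = - Fm N (fun A B C D => G A D C B) (fun i j k l => X i l k j) := by
  unfold Fm
  simp only [← Finset.sum_neg_distrib]
  refine Finset.sum_congr rfl fun i _ => ?_
  rw [Finset.sum_comm]
  conv_rhs => rw [Finset.sum_comm]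
  refine Finset.sum_congr rfl fun k _ => ?_
  rw [Finset.sum_comm]
  refine Finset.sum_congr rfl fun l _ => Finset.sum_congr rfl fun j _ =>
    Finset.sum_congr rfl fun A _ => ?_
  rw [Finset.sum_comm]
  conv_rhs => rw [Finset.sum_comm]
  refine Finset.sum_congr rfl fun C _ => ?_
  rw [Finset.sum_comm]
  refine Finset.sum_congr rfl fun D _ => Finset.sum_congr rfl fun B _ => ?_
  rw [Qm_swap, smul_neg]

lemma completeness (N : ℕ) (hN : 2 ≤ N)
    (T : Fin (N ^ 2 - 1) → Matrix (Fin N) (Fin N) ℂ)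
    (htr : ∀ a, (T a).trace = 0)
    (horth : ∀ a b, (T a * T b).trace = if a = b then (1 / 2 : ℂ) else 0) (i j k l : Fin N) :
    ∑ a, T a i j * T a k l = (1 / 2) * ((1 : Matrix (Fin N) (Fin N) ℂ) i l * (1 : Matrix (Fin N) (Fin N) ℂ) k j)
      + (-(1 / (2 * N))) * ((1 : Matrix (Fin N) (Fin N) ℂ) i j * (1 : Matrix (Fin N) (Fin N) ℂ) k l) := by
  have hN0 : (N : ℂ) ≠ 0 := by
    have : N ≠ 0 := by omega
    exact_mod_cast this
  let M : Matrix (Option (Fin (N ^ 2 - 1))) (Fin N × Fin N) ℂ := fun a p =>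
    match a with
    | none => (1 / N : ℂ) * (1 : Matrix (Fin N) (Fin N) ℂ) p.1 p.2
    | some a => 2 * T a p.1 p.2
  let M' : Matrix (Fin N × Fin N) (Option (Fin (N ^ 2 - 1))) ℂ := fun p a =>
    match a with
    | none => (1 : Matrix (Fin N) (Fin N) ℂ) p.2 p.1
    | some a => T a p.2 p.1
  have hcard : Fintype.card (Option (Fin (N ^ 2 - 1))) = Fintype.card (Fin N × Fin N) := by
    have : 0 < N ^ 2 := by positivity
    simp only [Fintype.card_option, Fintype.card_fin, Fintype.card_prod]
    rw [← pow_two]; omega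
  have h1 : M * M' = 1 := by
    ext a b
    have tr2 : ∀ X Y : Matrix (Fin N) (Fin N) ℂ,
        ∑ p : Fin N × Fin N, X p.1 p.2 * Y p.2 p.1 = (X * Y).trace := by
      intro X Y
      simp [Fintype.sum_prod_type, Matrix.trace, Matrix.mul_apply]
    rw [Matrix.mul_apply]
    rcases a with _ | a <;> rcases b with _ | b <;> simp only [M, M', mul_assoc, ← Finset.mul_sum, tr2]
    · simp [hN0]
    · simp [htr]
    · simp [htr]
    · rw [horth, Matrix.one_apply]
      by_cases h : a = b <;> simp [h]
  have h2 : M' * M = 1 := (Matrix.mul_eq_one_comm_of_card_eq _ _ _ hcard).1 h1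
  have h3 := congrFun (congrFun h2 (j, i)) (k, l)
  rw [Matrix.mul_apply, Fintype.sum_option] at h3
  simp only [M, M'] at h3
  have h4 : (1 : Matrix (Fin N × Fin N) (Fin N × Fin N) ℂ) (j, i) (k, l)
      = (1 : Matrix (Fin N) (Fin N) ℂ) i l * (1 : Matrix (Fin N) (Fin N) ℂ) k j := by
    simp only [Matrix.one_apply, Prod.mk.injEq]
    by_cases h : j = k <;> by_cases h' : i = l <;> simp [h, h', eq_comm]
  rw [h4] at h3
  have h5 : ∑ x, T x i j * (2 * T x k l) = 2 * ∑ x, T x i j * T x k l := by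
    rw [Finset.mul_sum]; exact Finset.sum_congr rfl fun x _ => by ring
  rw [h5] at h3
  rw [← h3]
  field_simp
  ring

lemma γ5_eq : γ5 = !![0,0,1,0; 0,0,0,1; 1,0,0,0; 0,1,0,0] := by
  ext i j
  fin_cases i <;> fin_cases j <;>
    simp [γ5, γm, Matrix.mul_apply, Fin.sum_univ_four, ← mul_assoc]

def γ5m : Fin 4 → Matrix (Fin 4) (Fin 4) ℂ :=
  ![!![0,0,-1,0; 0,0,0,-1; 1,0,0,0; 0,1,0,0],
    !![0,-1,0,0; -1,0,0,0; 0,0,0,1; 0,0,1,0],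
    !![0,I,0,0; -I,0,0,0; 0,0,0,-I; 0,0,I,0],
    !![-1,0,0,0; 0,1,0,0; 0,0,1,0; 0,0,0,-1]]

lemma γ5m_eq (μ : Fin 4) : γ5 * γm μ = γ5m μ := by
  rw [γ5_eq]
  ext i j
  fin_cases μ <;> fin_cases i <;> fin_cases j <;>
    simp [γm, γ5m, Matrix.mul_apply, Fin.sum_univ_four]

set_option maxHeartbeats 4000000 in
lemma dirac_fierz (A B C D : Fin 4) :
    ∑ μ, (εs μ : ℂ) * (γm μ A D * γm μ C B) =
      (1 : Matrix (Fin 4) (Fin 4) ℂ) A B * (1 : Matrix (Fin 4) (Fin 4) ℂ) C D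
      - (1 / 2) * ∑ μ, (εs μ : ℂ) * (γm μ A B * γm μ C D)
      - (1 / 2) * ∑ μ, (εs μ : ℂ) * (γ5m μ A B * γ5m μ C D)
      - γ5 A B * γ5 C D := by
  rw [γ5_eq]
  simp only [Fin.sum_univ_four, εs]
  fin_cases A <;> fin_cases B <;> fin_cases C <;> fin_cases D <;>
    simp [γm, γ5m] <;> norm_num

/-- **Vector Fierz identity for U(N) fermions.** -/
theorem fierz_vector (N : ℕ) (hN : 2 ≤ N)
    (T : Fin (N ^ 2 - 1) → Matrix (Fin N) (Fin N) ℂ)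
    (htr : ∀ a, (T a).trace = 0)
    (hherm : ∀ a, (T a)ᴴ = T a)
    (horth : ∀ a b, (T a * T b).trace = if a = b then (1 / 2 : ℂ) else 0) :
    ∑ a, ∑ μ, (εs μ : ℂ) • (pairing N (γm μ) (T a) * pairing N (γm μ) (T a)) =
      (-(1 / 2) : ℂ) • (sing N 1 * sing N 1)
        + (((N : ℂ) - 2) / (4 * (N : ℂ))) • ∑ μ, (εs μ : ℂ) •
            (sing N (γm μ) * sing N (γm μ))
        + (1 / 4 : ℂ) • ∑ μ, (εs μ : ℂ) • (sing N (γ5 * γm μ) * sing N (γ5 * γm μ))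
        + (1 / 2 : ℂ) • (sing N γ5 * sing N γ5) := by
  have hN0 : (N : ℂ) ≠ 0 := by
    have : N ≠ 0 := by omega
    exact_mod_cast this
  rw [Finset.sum_comm]
  simp only [sing, γ5m_eq, pair_mul, ← Finset.smul_sum, Fm_sumX, completeness N hN T htr horth]
  simp only [← Fm_addX, Fm_smulX]
  simp only [Fm_swap N _ (fun i j k l => (1 : Matrix (Fin N) (Fin N) ℂ) i l *
    (1 : Matrix (Fin N) (Fin N) ℂ) k j)]
  simp only [← neg_one_smul ℂ (Fm N _ _), Fm_smul, Fm_add, Fm_sum]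
  congr 1
  funext A B C D
  have h := dirac_fierz A B C D
  simp only [Fin.sum_univ_four] at h ⊢
  field_simp at h ⊢
  linear_combination (-(2 * N : ℂ)) * h
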